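/- Let N ≥ 4, β > 0, and 1 < γ ≤ 2(N−1)/N. There is no global classical solution on [0,∞) of the N-dimensional Euler–Poisson equations with frictional damping βρu whose initial total energy satisfies E(0) < 0; i.e., every classical solution with E(0) < 0 blows up in finite time. -/

import Mathlib

open MeasureTheory Real Filter
open scoped RealInnerProductSpace Topology

noncomputable section

/-- Euclidean space `ℝ^N`. -/
abbrev Euc (N : ℕ) := EuclideanSpace ℝ (Fin N)

/-- Divergence of a vector field on `ℝ^N`. -/
def ediv {N : ℕ} (v : Euc N → Euc N) (x : Euc N) : ℝ :=
  ∑ i, fderiv ℝ (fun y => v y i) x (EuclideanSpace.single i 1)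

/-- Partial derivative of a scalar field in the `i`-th coordinate direction. -/
def epartial {N : ℕ} (i : Fin N) (f : Euc N → ℝ) (x : Euc N) : ℝ :=
  fderiv ℝ f x (EuclideanSpace.single i 1)

/-- Green's function of the Poisson equation in `ℝ^N`:
`log |x|` for `N = 2` and `-|x|^(2-N)` for `N ≥ 3`. -/
def green (N : ℕ) (x : Euc N) : ℝ :=
  if N = 2 then Real.log ‖x‖ else -(‖x‖ ^ ((2 : ℝ) - (N : ℝ)))

/-- Gravitational potential `Φ(t,x) = g ∫ G(x-y) ρ(t,y) dy`. -/
def potential (N : ℕ) (g : ℝ) (ρ : ℝ → Euc N → ℝ) (t : ℝ) (x : Euc N) : ℝ :=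
  g * ∫ y, green N (x - y) * ρ t y

/-- A classical solution on `[0,T)` (with `T : EReal`, so `T = ⊤` means a global
solution) of the `N`-dimensional Euler–Poisson equations with pressure
`P = K ρ^γ`, damping constant `β` and gravitational constant `g`:
nonnegative `C¹` density `ρ`, `C¹` velocity `u`, with `ρ(t,·)` supported in a
fixed bounded open set `Ω`, satisfying the continuity and momentum equations
pointwise. -/
structure IsEPSolution (N : ℕ) (K γ β g : ℝ) (Ω : Set (Euc N)) (T : EReal)
    (ρ : ℝ → Euc N → ℝ) (u : ℝ → Euc N → Euc N) : Prop where
  rho_nonneg : ∀ t x, 0 ≤ ρ t x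
  rho_C1 : ContDiff ℝ 1 (fun p : ℝ × Euc N => ρ p.1 p.2)
  u_C1 : ContDiff ℝ 1 (fun p : ℝ × Euc N => u p.1 p.2)
  omega_open : IsOpen Ω
  omega_bounded : Bornology.IsBounded Ω
  support_subset : ∀ t : ℝ, 0 ≤ t → (t : EReal) < T → Function.support (ρ t) ⊆ Ω
  continuity_eq : ∀ t : ℝ, 0 ≤ t → (t : EReal) < T → ∀ x : Euc N,
    deriv (fun s => ρ s x) t + ediv (fun y => ρ t y • u t y) x = 0
  momentum_eq : ∀ t : ℝ, 0 ≤ t → (t : EReal) < T → ∀ x : Euc N, ∀ j : Fin N,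
    deriv (fun s => ρ s x * u s x j) t
      + (∑ i, epartial i (fun y => ρ t y * u t y i * u t y j) x)
      + epartial j (fun y => K * ρ t y ^ γ) x
      = -(ρ t x * epartial j (potential N g ρ t) x) - β * ρ t x * u t x j

/-- Total energy (case `γ > 1`):
`E(t) = ∫_Ω (½ ρ|u|² + P/(γ-1) + ½ ρΦ) dx` with `P = K ρ^γ`. -/
def energy (N : ℕ) (K γ g : ℝ) (Ω : Set (Euc N)) (ρ : ℝ → Euc N → ℝ)
    (u : ℝ → Euc N → Euc N) (t : ℝ) : ℝ :=
  ∫ x in Ω, ((1 / 2) * ρ t x * ‖u t x‖ ^ 2 + K * ρ t x ^ γ / (γ - 1)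
    + (1 / 2) * ρ t x * potential N g ρ t x)

/-- Isothermal total energy (case `γ = 1`, `P = Kρ`):
`E(t) = ∫_Ω (½ ρ|u|² + Kρ log ρ + ½ ρΦ) dx` (note `ρ log ρ = 0` where `ρ = 0`
since `Real.log 0 = 0`). -/
def energyIso (N : ℕ) (K g : ℝ) (Ω : Set (Euc N)) (ρ : ℝ → Euc N → ℝ)
    (u : ℝ → Euc N → Euc N) (t : ℝ) : ℝ :=
  ∫ x in Ω, ((1 / 2) * ρ t x * ‖u t x‖ ^ 2 + K * ρ t x * Real.log (ρ t x)
    + (1 / 2) * ρ t x * potential N g ρ t x)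

/-- Second inertia function `H(t) = ∫_Ω ρ(t,x)|x|² dx`. -/
def inertia (N : ℕ) (Ω : Set (Euc N)) (ρ : ℝ → Euc N → ℝ) (t : ℝ) : ℝ :=
  ∫ x in Ω, ρ t x * ‖x‖ ^ 2

/-- Maximal radius of the support of `ρ(t,·)`. -/
def maxRadius (N : ℕ) (ρ : ℝ → Euc N → ℝ) (t : ℝ) : ℝ :=
  sSup ((fun x : Euc N => ‖x‖) '' Function.support (ρ t))

lemma green_locInt {N : ℕ} (hN : 4 ≤ N) : LocallyIntegrable (green N) volume := by
  have hdim : Module.finrank ℝ (Euc N) = N := by simp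
  have hN' : (4:ℝ) ≤ N := by exact_mod_cast hN
  refine locallyIntegrable_of_norm_le_rpow (C := 1) (α := (N:ℝ) - 2) ?_ ?_ ?_ ?_
  · rw [hdim]; omega
  · rw [hdim]; linarith
  · refine Eventually.of_forall fun x => ?_
    have : N ≠ 2 := by omega
    simp only [green, this, if_false, norm_neg, one_mul, neg_sub]
    rw [Real.norm_of_nonneg (by positivity)]
  · have : N ≠ 2 := by omega
    have h : Measurable (green N) := by
      unfold green
      simp only [this, if_false]
      fun_prop
    exact h.aestronglyMeasurable

lemma green_smul {N : ℕ} (hN : 4 ≤ N) {l : ℝ} (hl : 0 < l) (x : Euc N) :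
    green N (l • x) = l ^ ((2:ℝ) - N) * green N x := by
  have : N ≠ 2 := by omega
  simp only [green, this, if_false, norm_smul, Real.norm_of_nonneg hl.le]
  rw [Real.mul_rpow hl.le (norm_nonneg _)]; ring

lemma green_neg {N : ℕ} (x : Euc N) : green N (-x) = green N x := by
  simp [green]

/-- kernel integrable on a product of balls -/
lemma kernel_int {N : ℕ} (hN : 4 ≤ N) (R : ℝ) :
    IntegrableOn (fun z : Euc N × Euc N => green N (z.1 - z.2))
      (Metric.closedBall (0 : Euc N) R ×ˢ Metric.closedBall (0 : Euc N) R) volume := by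
  have hB : MeasurableSet (Metric.closedBall (0 : Euc N) R) := Metric.isClosed_closedBall.measurableSet
  have h1 : Integrable ((Metric.closedBall (0 : Euc N) R).indicator (fun _ => (1:ℝ))) volume := by
    rw [integrable_indicator_iff hB]
    exact integrableOn_const (by exact (isCompact_closedBall _ _).measure_lt_top.ne)
  have h2 : Integrable ((Metric.closedBall (0 : Euc N) (2*R)).indicator (green N)) volume := by
    rw [integrable_indicator_iff Metric.isClosed_closedBall.measurableSet]
    exact (green_locInt hN).integrableOn_isCompact (isCompact_closedBall _ _)
  have h3 := (h1.convolution_integrand (ContinuousLinearMap.mul ℝ ℝ) h2)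
  refine (h3.integrableOn (s := (Metric.closedBall (0 : Euc N) R ×ˢ Metric.closedBall (0 : Euc N) R))).congr_fun ?_ (hB.prod hB)
  rintro ⟨x, y⟩ ⟨hx, hy⟩
  have hxy : x - y ∈ Metric.closedBall (0 : Euc N) (2*R) := by
    simp only [mem_closedBall_zero_iff] at *
    linarith [norm_sub_le x y]
  simp only at hx hy
  simp [Set.indicator_of_mem hy, Set.indicator_of_mem hxy]

lemma hasDerivAt_param {X : Type*} [TopologicalSpace X] [MeasurableSpace X] [OpensMeasurableSpace X]
    [T2Space X] [SecondCountableTopology X]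
    (μ : Measure X) {B : Set X} (hB : IsCompact B) {k : X → ℝ} (hk : IntegrableOn k B μ)
    {F F' : ℝ × X → ℝ} (hF : Continuous F) (hF' : Continuous F')
    (hd : ∀ t x, HasDerivAt (fun s => F (s, x)) (F' (t, x)) t) (t : ℝ) :
    HasDerivAt (fun s => ∫ x in B, k x * F (s, x) ∂μ) (∫ x in B, k x * F' (t, x) ∂μ) t := by
  have hBm : MeasurableSet B := hB.measurableSet
  obtain ⟨C, hC⟩ := ((isCompact_Icc (a := t - 1) (b := t + 1)).prod hB).exists_bound_of_continuousOn
    hF'.continuousOn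
  obtain ⟨C0, hC0⟩ := hB.exists_bound_of_continuousOn (f := fun x => F (t, x))
    (by fun_prop : Continuous fun x => F (t, x)).continuousOn
  have hm : ∀ (f : X → ℝ), Continuous f → AEStronglyMeasurable f (μ.restrict B) :=
    fun f hf => hf.measurable.aestronglyMeasurable
  refine (hasDerivAt_integral_of_dominated_loc_of_deriv_le (μ := μ.restrict B)
    (s := Set.Icc (t-1) (t+1)) (bound := fun x => ‖k x‖ * C)
    (F := fun s x => k x * F (s, x)) (F' := fun s x => k x * F' (s, x))
    (Icc_mem_nhds (by linarith) (by linarith)) ?_ ?_ ?_ ?_ ?_ ?_).2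
  · exact Eventually.of_forall fun s => hk.aestronglyMeasurable.mul (hm _ (by fun_prop))
  · refine Integrable.mul_bdd (c := C0) hk (hm _ (by fun_prop)) ?_
    exact (ae_restrict_iff' hBm).2 (Eventually.of_forall hC0)
  · exact hk.aestronglyMeasurable.mul (hm _ (by fun_prop))
  · refine (ae_restrict_iff' hBm).2 (Eventually.of_forall fun x hx s hs => ?_)
    rw [norm_mul]
    exact mul_le_mul_of_nonneg_left (hC (s, x) ⟨hs, hx⟩) (norm_nonneg _)
  · exact hk.norm.mul_const C
  · exact Eventually.of_forall fun x s _ => (hd s x).const_mul _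

lemma hasDerivAt_param_C1 {X : Type*} [NormedAddCommGroup X] [NormedSpace ℝ X] [MeasurableSpace X] [OpensMeasurableSpace X]
    [SecondCountableTopology X]
    (μ : Measure X) {B : Set X} (hB : IsCompact B) {k : X → ℝ} (hk : IntegrableOn k B μ)
    {F : ℝ → X → ℝ} (hF : ContDiff ℝ 1 (fun p : ℝ × X => F p.1 p.2)) (t : ℝ) :
    HasDerivAt (fun s => ∫ x in B, k x * F s x ∂μ)
      (∫ x in B, k x * deriv (fun s => F s x) t ∂μ) t := by
  have hd : ∀ t x, HasDerivAt (fun s => F s x)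
      (fderiv ℝ (fun p : ℝ × X => F p.1 p.2) (t, x) (1, 0)) t := by
    intro t x
    have h1 := (hF.differentiable (by norm_num) (t, x)).hasFDerivAt
    exact h1.comp_hasDerivAt (f := fun s => (s, x)) t ((hasDerivAt_id t).prodMk (hasDerivAt_const t x))
  have hc : Continuous (fun p : ℝ × X => fderiv ℝ (fun p : ℝ × X => F p.1 p.2) p (1, 0)) :=
    (hF.continuous_fderiv (by norm_num)).clm_apply continuous_const
  have := hasDerivAt_param μ hB hk hF.continuous hc hd t
  simpa only [(hd _ _).deriv] using this

lemma potential_C1 {N : ℕ} (hN : 4 ≤ N) (g : ℝ) {ρ : ℝ → Euc N → ℝ} {t : ℝ}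
    (h1 : ContDiff ℝ 1 (ρ t)) (h2 : HasCompactSupport (ρ t)) :
    ContDiff ℝ 1 (potential N g ρ t) := by
  have := h2.contDiff_convolution_right (n := 1) (ContinuousLinearMap.mul ℝ ℝ) (green_locInt hN) h1
  have e : potential N g ρ t = fun x => g * (MeasureTheory.convolution (green N) (ρ t) (ContinuousLinearMap.mul ℝ ℝ) volume) x := by
    funext x
    rw [convolution_eq_swap]
    rfl
  rw [e]
  exact contDiff_const.mul this

lemma epartial_zero_off {N : ℕ} {B : Set (Euc N)} (hB : IsClosed B) {f : Euc N → ℝ}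
    (hs : ∀ x, x ∉ B → f x = 0) (i : Fin N) : ∀ x, x ∉ B → epartial i f x = 0 := by
  intro x hx
  have : f =ᶠ[𝓝 x] fun _ => 0 := by
    filter_upwards [hB.isOpen_compl.mem_nhds hx] with y hy using hs y hy
  unfold epartial
  rw [this.fderiv_eq]; simp

lemma epartial_cont {N : ℕ} {f : Euc N → ℝ} (hf : ContDiff ℝ 1 f) (i : Fin N) :
    Continuous (epartial i f) :=
  (hf.continuous_fderiv (by norm_num)).clm_apply continuous_const

lemma int_epartial {N : ℕ} {B : Set (Euc N)} (hB : IsCompact B) {f : Euc N → ℝ}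
    (hf : ContDiff ℝ 1 f)
    (hs : ∀ x, x ∉ B → f x = 0) (i : Fin N) : ∫ x in B, epartial i f x = 0 := by
  have h0 := epartial_zero_off hB.isClosed hs i
  rw [setIntegral_eq_integral_of_forall_compl_eq_zero h0]
  have hcs : HasCompactSupport f := HasCompactSupport.intro hB hs
  have hcs' : HasCompactSupport (epartial i f) := HasCompactSupport.intro hB h0
  have := integral_bilinear_fderiv_right_eq_neg_left_of_integrable (μ := volume)
    (f := fun _ : Euc N => (1:ℝ)) (g := f)
    (v := EuclideanSpace.single i 1) (B := ContinuousLinearMap.mul ℝ ℝ) (by simp)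
    (by simp only [ContinuousLinearMap.mul_apply', one_mul]; exact (epartial_cont hf i).integrable_of_hasCompactSupport hcs')
    (by simpa using hf.continuous.integrable_of_hasCompactSupport hcs)
    (by intro x _; fun_prop) (by intro x _; exact hf.differentiable (by norm_num) x)
  simpa [epartial] using this

lemma pot_pair {N : ℕ} (hN : 4 ≤ N) (g R : ℝ) {ρ : ℝ → Euc N → ℝ} {t : ℝ} {f : Euc N → ℝ}
    (hf : Continuous f) (hr : Continuous (ρ t))
    (hs : ∀ x, x ∉ Metric.closedBall (0 : Euc N) R → ρ t x = 0) :
    g * ∫ z in Metric.closedBall (0 : Euc N) R ×ˢ Metric.closedBall (0 : Euc N) R,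
      green N (z.1 - z.2) * (f z.1 * ρ t z.2)
      = ∫ x in Metric.closedBall (0 : Euc N) R, f x * potential N g ρ t x := by
  have hcB := isCompact_closedBall (0 : Euc N) R
  have hint : IntegrableOn (fun z : Euc N × Euc N => green N (z.1 - z.2) * (f z.1 * ρ t z.2))
      (Metric.closedBall (0 : Euc N) R ×ˢ Metric.closedBall (0 : Euc N) R) volume :=
    (kernel_int hN R).mul_continuousOn (by fun_prop) (hcB.prod hcB)
  rw [Measure.volume_eq_prod] at hint ⊢
  rw [setIntegral_prod _ hint, ← integral_const_mul]
  refine integral_congr_ae (Eventually.of_forall fun x => ?_)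
  simp only [potential]
  have e : ∫ y, green N (x - y) * ρ t y = ∫ y in Metric.closedBall (0 : Euc N) R, green N (x - y) * ρ t y :=
    (setIntegral_eq_integral_of_forall_compl_eq_zero
      (fun y hy => by rw [hs y hy, mul_zero])).symm
  rw [e]
  rw [← integral_const_mul, ← integral_const_mul, ← integral_const_mul]
  congr 1; funext y; ring

lemma pot_pair' {N : ℕ} (hN : 4 ≤ N) (g R : ℝ) {ρ : ℝ → Euc N → ℝ} {t : ℝ} {f : Euc N → ℝ}
    (hf : Continuous f) (hr : Continuous (ρ t))
    (hs : ∀ x, x ∉ Metric.closedBall (0 : Euc N) R → ρ t x = 0) :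
    g * ∫ z in Metric.closedBall (0 : Euc N) R ×ˢ Metric.closedBall (0 : Euc N) R,
      green N (z.1 - z.2) * (ρ t z.1 * f z.2)
      = ∫ x in Metric.closedBall (0 : Euc N) R, f x * potential N g ρ t x := by
  rw [← pot_pair hN g R hf hr hs]
  congr 1
  rw [Measure.volume_eq_prod, ← setIntegral_prod_swap]
  congr 1; funext z
  simp only [Prod.fst_swap, Prod.snd_swap]
  rw [← green_neg, neg_sub]; ring

lemma pot_pair_sym {N : ℕ} (hN : 4 ≤ N) (g R : ℝ) {ρ : ℝ → Euc N → ℝ} {t : ℝ} {f : Euc N → ℝ}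
    (hf : Continuous f) (hr : Continuous (ρ t))
    (hs : ∀ x, x ∉ Metric.closedBall (0 : Euc N) R → ρ t x = 0) :
    g * ∫ z in Metric.closedBall (0 : Euc N) R ×ˢ Metric.closedBall (0 : Euc N) R,
      green N (z.1 - z.2) * (f z.1 * ρ t z.2 + ρ t z.1 * f z.2)
      = 2 * ∫ x in Metric.closedBall (0 : Euc N) R, f x * potential N g ρ t x := by
  have hcB := isCompact_closedBall (0 : Euc N) R
  have hint : ∀ k : Euc N × Euc N → ℝ, Continuous k →
      IntegrableOn (fun z : Euc N × Euc N => green N (z.1 - z.2) * k z)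
      (Metric.closedBall (0 : Euc N) R ×ˢ Metric.closedBall (0 : Euc N) R) volume := fun k hk =>
    (kernel_int hN R).mul_continuousOn (by fun_prop) (hcB.prod hcB)
  simp_rw [mul_add]
  rw [integral_add (hint _ (by fun_prop)) (hint _ (by fun_prop)), mul_add,
    pot_pair hN g R hf hr hs, pot_pair' hN g R hf hr hs]
  ring

lemma fderiv_apply_sum {N : ℕ} (f : Euc N → ℝ) (x y : Euc N) :
    fderiv ℝ f x y = ∑ i, y i * epartial i f x := by
  have : y = ∑ i, y i • (EuclideanSpace.single i (1:ℝ) : Euc N) := by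
    ext j; simp [Finset.sum_apply, Pi.single_apply]
  conv_lhs => rw [this]
  simp [epartial]

lemma virial {N : ℕ} (hN : 4 ≤ N) (g : ℝ) {R : ℝ} (hR : 0 < R) {ρ : ℝ → Euc N → ℝ} {t : ℝ}
    (hr : ContDiff ℝ 1 (ρ t))
    (hs : ∀ x, x ∉ Metric.closedBall (0 : Euc N) R → ρ t x = 0) :
    ∫ x in Metric.closedBall (0 : Euc N) R, (∑ i, x i * epartial i (ρ t) x) * potential N g ρ t x
      = - ((N + 2) / 2) * ∫ x in Metric.closedBall (0 : Euc N) R, ρ t x * potential N g ρ t x := by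
  set B2 := Metric.closedBall (0 : Euc N) (2 * R) with hB2
  have hsub : ∀ x : Euc N, x ∉ B2 → x ∉ Metric.closedBall (0 : Euc N) R := by
    intro x hx; simp only [hB2, mem_closedBall_zero_iff, not_le] at *; linarith
  have hs2 : ∀ x, x ∉ B2 → ρ t x = 0 := fun x hx => hs x (hsub x hx)
  have hcB : IsCompact B2 := isCompact_closedBall (0 : Euc N) (2*R)
  have hd0 : ∀ x, x ∉ Metric.closedBall (0 : Euc N) R → (∑ i, x i * epartial i (ρ t) x) = 0 := by
    intro x hx
    refine Finset.sum_eq_zero fun i _ => ?_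
    rw [epartial_zero_off Metric.isClosed_closedBall hs i x hx, mul_zero]
  -- move to the big ball
  have e1 : ∀ f : Euc N → ℝ, (∀ x, x ∉ Metric.closedBall (0 : Euc N) R → f x = 0) →
      ∫ x in Metric.closedBall (0 : Euc N) R, f x * potential N g ρ t x
       = ∫ x in B2, f x * potential N g ρ t x := by
    intro f hf
    rw [setIntegral_eq_integral_of_forall_compl_eq_zero (fun x hx => by rw [hf x hx, zero_mul]),
      setIntegral_eq_integral_of_forall_compl_eq_zero (fun x hx => by rw [hf x (hsub x hx), zero_mul])]
  rw [e1 _ hd0, e1 _ hs]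
  have hcd : Continuous fun x : Euc N => ∑ i, x i * epartial i (ρ t) x := by
    refine continuous_finsetSum _ fun i _ => ?_
    have := epartial_cont hr i
    fun_prop
  -- derivative of the dilated self-energy
  have hF : ContDiff ℝ 1 (fun p : ℝ × (Euc N × Euc N) => ρ t (p.1 • p.2.1) * ρ t (p.1 • p.2.2)) := by
    fun_prop
  have hD := hasDerivAt_param_C1 (volume : Measure (Euc N × Euc N)) (hcB.prod hcB) (kernel_int hN (2*R))
    (F := fun l z => ρ t (l • z.1) * ρ t (l • z.2)) hF 1
  have hder : ∀ z : Euc N × Euc N, deriv (fun l : ℝ => ρ t (l • z.1) * ρ t (l • z.2)) 1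
      = (∑ i, z.1 i * epartial i (ρ t) z.1) * ρ t z.2 + ρ t z.1 * (∑ i, z.2 i * epartial i (ρ t) z.2) := by
    intro z
    have h1 : ∀ x : Euc N, HasDerivAt (fun l : ℝ => ρ t (l • x)) (∑ i, x i * epartial i (ρ t) x) 1 := by
      intro x
      rw [← fderiv_apply_sum]
      have hx : HasDerivAt (fun l : ℝ => l • x) x 1 := by
        simpa using (hasDerivAt_id (1:ℝ)).smul_const x
      have hf : HasFDerivAt (ρ t) (fderiv ℝ (ρ t) x) ((1:ℝ) • x) := by
        rw [one_smul]; exact (hr.differentiable (by norm_num) x).hasFDerivAt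
      exact hf.comp_hasDerivAt (1:ℝ) hx
    have := ((h1 z.1).fun_mul (h1 z.2)).deriv
    simpa using this
  simp only [hder] at hD
  -- scaling
  set W := ∫ z in B2 ×ˢ B2, green N (z.1 - z.2) * (ρ t z.1 * ρ t z.2) with hW
  have hscale : ∀ l : ℝ, 1/2 < l → (∫ z in B2 ×ˢ B2, green N (z.1 - z.2) * (ρ t (l • z.1) * ρ t (l • z.2)))
      = l ^ (-((N:ℝ) + 2)) * W := by
    intro l hl
    have hl0 : 0 < l := by linarith
    have hzero : ∀ x : Euc N, x ∉ B2 → ρ t (l • x) = 0 := by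
      intro x hx
      apply hs
      simp only [hB2, mem_closedBall_zero_iff, not_le, norm_smul, Real.norm_of_nonneg hl0.le] at *
      nlinarith
    rw [hW, setIntegral_eq_integral_of_forall_compl_eq_zero, setIntegral_eq_integral_of_forall_compl_eq_zero]
    rotate_left
    · rintro ⟨x, y⟩ hxy
      by_cases hx : x ∈ B2
      · have hy : y ∉ B2 := fun hy => hxy ⟨hx, hy⟩
        simp [hs2 y hy]
      · simp [hs2 x hx]
    · rintro ⟨x, y⟩ hxy
      by_cases hx : x ∈ B2
      · have hy : y ∉ B2 := fun hy => hxy ⟨hx, hy⟩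
        simp [hzero y hy]
      · simp [hzero x hx]
    have hsm := Measure.integral_comp_smul ((volume : Measure (Euc N)).prod (volume : Measure (Euc N)))
      (fun z => green N (z.1 - z.2) * (ρ t z.1 * ρ t z.2)) l
    rw [← Measure.volume_eq_prod] at hsm
    have hfr : Module.finrank ℝ (Euc N × Euc N) = N + N := by simp
    rw [hfr] at hsm
    simp only [Prod.smul_fst, Prod.smul_snd, ← smul_sub, green_smul hN hl0, smul_eq_mul, mul_assoc] at hsm
    rw [integral_const_mul] at hsm
    have hne : l ^ ((2:ℝ) - N) ≠ 0 := (Real.rpow_pos_of_pos hl0 _).ne'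
    apply mul_left_cancel₀ hne
    rw [hsm, ← mul_assoc, ← Real.rpow_add hl0, abs_of_pos (by positivity), ← Real.rpow_natCast,
      ← Real.rpow_neg hl0.le]
    congr 2
    push_cast; ring
  have hD2 : HasDerivAt (fun l : ℝ => l ^ (-((N:ℝ) + 2)) * W) (-((N:ℝ)+2) * W) 1 := by
    have := (Real.hasDerivAt_rpow_const (x := 1) (p := -((N:ℝ) + 2)) (Or.inl one_ne_zero)).mul_const W
    simpa using this
  have hD3 := hD.congr_of_eventuallyEq (f₁ := fun l : ℝ => l ^ (-((N:ℝ) + 2)) * W) (by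
    filter_upwards [lt_mem_nhds (by norm_num : (1/2:ℝ) < 1)] with l hl
    rw [hscale l hl])
  have key := hD3.unique hD2
  have k1 := pot_pair_sym hN g (2*R) hcd hr.continuous hs2
  have k2 := pot_pair hN g (2*R) hr.continuous hr.continuous hs2
  rw [← hB2] at k1 k2
  rw [key] at k1
  rw [← hW] at k2
  rw [← k2]
  linarith

lemma epartial_mul {N : ℕ} {f h : Euc N → ℝ} {x : Euc N} (hf : DifferentiableAt ℝ f x)
    (hh : DifferentiableAt ℝ h x) (i : Fin N) :
    epartial i (fun y => f y * h y) x = epartial i f x * h x + f x * epartial i h x := by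
  unfold epartial
  rw [fderiv_fun_mul hf hh]
  simp; ring

lemma epartial_coord {N : ℕ} (i j : Fin N) (x : Euc N) :
    epartial i (fun y : Euc N => y j) x = if j = i then 1 else 0 := by
  have h : HasFDerivAt (fun y : Euc N => y j) (EuclideanSpace.proj j : Euc N →L[ℝ] ℝ) x :=
    (EuclideanSpace.proj j : Euc N →L[ℝ] ℝ).hasFDerivAt
  unfold epartial
  rw [h.fderiv]
  simp

lemma epartial_add {N : ℕ} {f h : Euc N → ℝ} {x : Euc N} (hf : DifferentiableAt ℝ f x)
    (hh : DifferentiableAt ℝ h x) (i : Fin N) :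
    epartial i (fun y => f y + h y) x = epartial i f x + epartial i h x := by
  unfold epartial
  rw [fderiv_fun_add hf hh]; rfl

lemma epartial_const_mul {N : ℕ} {f : Euc N → ℝ} {x : Euc N} (hf : DifferentiableAt ℝ f x)
    (c : ℝ) (i : Fin N) :
    epartial i (fun y => c * f y) x = c * epartial i f x := by
  unfold epartial
  rw [fderiv_const_mul hf]; rfl

lemma epartial_sum {N : ℕ} {f : Fin N → Euc N → ℝ} {x : Euc N} (hf : ∀ j, DifferentiableAt ℝ (f j) x)
    (i : Fin N) :
    epartial i (fun y => ∑ j, f j y) x = ∑ j, epartial i (f j) x := by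
  unfold epartial
  rw [fderiv_fun_sum (fun j _ => hf j)]; simp

lemma epartial_sq {N : ℕ} {f : Euc N → ℝ} {x : Euc N} (hf : DifferentiableAt ℝ f x) (i : Fin N) :
    epartial i (fun y => f y ^ 2) x = 2 * f x * epartial i f x := by
  simp only [pow_two]
  rw [epartial_mul hf hf]; ring

lemma epartial_rpow {N : ℕ} {f : Euc N → ℝ} {x : Euc N} (hf : DifferentiableAt ℝ f x) {γ : ℝ}
    (hγ : 1 ≤ γ) (i : Fin N) :
    epartial i (fun y => f y ^ γ) x = γ * f x ^ (γ - 1) * epartial i f x := by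
  unfold epartial
  rw [(hf.hasFDerivAt.rpow_const (Or.inr hγ)).fderiv]; rfl

lemma energy_alg (N : ℕ) (r rt φ q K γ β : ℝ) (ri ui ut φi : Fin N → ℝ) (du : Fin N → Fin N → ℝ)
    (hγ : γ - 1 ≠ 0)
    (hc : rt + ∑ i, (ri i * ui i + r * du i i) = 0)
    (hm : ∀ j, (rt * ui j + r * ut j) + ∑ i, ((ri i * ui i + r * du i i) * ui j + r * ui i * du i j)
      + K * (γ * q * ri j) = -(r * φi j) - β * r * ui j) :
    (1 / 2 * rt * ∑ j, ui j ^ 2 + 1 / 2 * r * ∑ j, 2 * ui j * ut j) + K * (γ * q * rt) / (γ - 1) + rt * φ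
    = - (∑ i, (1 / 2 * ((ri i * ui i + r * du i i) * (∑ j, ui j ^ 2) + r * ui i * ∑ j, 2 * ui j * du i j)
        + γ / (γ - 1) * (K * (γ * q * ri i) * ui i + K * (r * q) * du i i)
        + ((ri i * ui i + r * du i i) * φ + r * ui i * φi i))) - β * (r * ∑ j, ui j ^ 2) := by
  set S := ∑ j, ui j ^ 2 with hS
  set D := ∑ i, (ri i * ui i + r * du i i) with hD
  set a := ∑ i, ri i * ui i with ha
  set b := ∑ i, du i i with hb
  set d := ∑ i, φi i * ui i with hd
  set e := ∑ i, ui i * ut i with he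
  set c := ∑ i, ui i * ∑ j, ui j * du i j with hcc
  have hDab : D = a + r * b := by
    rw [hD, ha, hb, Finset.mul_sum, ← Finset.sum_add_distrib]
  have hm' : ∀ j, r * (ui j * ut j) + r * (∑ i, ui i * (ui j * du i j)) + K * γ * q * (ri j * ui j)
      = - r * (φi j * ui j) - β * r * ui j ^ 2 := by
    intro j
    have h := hm j
    rw [Finset.sum_add_distrib, ← Finset.sum_mul, ← hD] at h
    have h2 : ∑ i, ui i * (ui j * du i j) = ui j * ∑ i, ui i * du i j := by
      rw [Finset.mul_sum]; exact Finset.sum_congr rfl fun i _ => by ring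
    have h3 : ∑ i, r * ui i * du i j = r * ∑ i, ui i * du i j := by
      rw [Finset.mul_sum]; exact Finset.sum_congr rfl fun i _ => by ring
    rw [h2]; rw [h3] at h
    linear_combination ui j * h - ui j ^ 2 * hc
  have hsum : r * e + r * c + K * γ * q * a = - r * d - β * r * S := by
    have h := Finset.sum_congr rfl (fun j (_ : j ∈ Finset.univ) => hm' j)
    rw [Finset.sum_add_distrib, Finset.sum_add_distrib, Finset.sum_sub_distrib] at h
    simp only [← Finset.mul_sum] at h
    rw [Finset.sum_comm] at h
    simp only [← Finset.mul_sum] at h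
    exact h
  have hrhs : (∑ i, (1 / 2 * ((ri i * ui i + r * du i i) * S + r * ui i * ∑ j, 2 * ui j * du i j)
        + γ / (γ - 1) * (K * (γ * q * ri i) * ui i + K * (r * q) * du i i)
        + ((ri i * ui i + r * du i i) * φ + r * ui i * φi i)))
      = 1 / 2 * S * D + r * c + γ / (γ - 1) * (K * γ * q * a + K * r * q * b) + (D * φ + r * d) := by
    have : ∀ i, (1 / 2 * ((ri i * ui i + r * du i i) * S + r * ui i * ∑ j, 2 * ui j * du i j)
        + γ / (γ - 1) * (K * (γ * q * ri i) * ui i + K * (r * q) * du i i)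
        + ((ri i * ui i + r * du i i) * φ + r * ui i * φi i))
        = (1 / 2 * S + φ) * (ri i * ui i + r * du i i) + r * (ui i * ∑ j, ui j * du i j)
         + γ / (γ - 1) * K * γ * q * (ri i * ui i) + γ / (γ - 1) * K * r * q * du i i
         + r * (φi i * ui i) := by
      intro i
      have : ∑ j, 2 * ui j * du i j = 2 * ∑ j, ui j * du i j := by
        rw [Finset.mul_sum]; exact Finset.sum_congr rfl fun j _ => by ring
      rw [this]; ring
    simp only [this, Finset.sum_add_distrib]
    simp only [← Finset.mul_sum]
    rw [← hD, ← hcc, ← ha, ← hb, ← hd]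
    ring
  rw [hrhs]
  have he2 : ∑ j, 2 * ui j * ut j = 2 * e := by
    rw [he, Finset.mul_sum]; exact Finset.sum_congr rfl fun j _ => by ring
  rw [he2]
  have hrt : rt = - (a + r * b) := by rw [← hDab]; linarith
  rw [hDab]
  have hre : r * e = - r * d - β * r * S - r * c - K * γ * q * a := by linarith
  have : 1 / 2 * r * (2 * e) = r * e := by ring
  rw [this, hre, hrt]
  field_simp
  ring

section evo

variable {N : ℕ} {K γ β g : ℝ} {Ω : Set (Euc N)} {ρ : ℝ → Euc N → ℝ} {u : ℝ → Euc N → Euc N}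

lemma sol_uj (hsol : IsEPSolution N K γ β g Ω ⊤ ρ u) (j : Fin N) :
    ContDiff ℝ 1 (fun p : ℝ × Euc N => u p.1 p.2 j) :=
  contDiff_euclidean.1 hsol.u_C1 j

lemma slice_C1 {F : ℝ → Euc N → ℝ} (hF : ContDiff ℝ 1 (fun p : ℝ × Euc N => F p.1 p.2)) (t : ℝ) :
    ContDiff ℝ 1 (F t) :=
  hF.comp (contDiff_const.prodMk contDiff_id)

lemma slice_t {F : ℝ → Euc N → ℝ} (hF : ContDiff ℝ 1 (fun p : ℝ × Euc N => F p.1 p.2)) (t : ℝ)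
    (x : Euc N) : HasDerivAt (fun s => F s x) (deriv (fun s => F s x) t) t := by
  have : ContDiff ℝ 1 (fun s => F s x) := hF.comp (contDiff_id.prodMk contDiff_const)
  exact (this.differentiable (by norm_num) t).hasDerivAt

lemma cont_deriv_t {F : ℝ → Euc N → ℝ} (hF : ContDiff ℝ 1 (fun p : ℝ × Euc N => F p.1 p.2)) (t : ℝ) :
    Continuous (fun x => deriv (fun s => F s x) t) := by
  have hd : ∀ x, HasDerivAt (fun s => F s x)
      (fderiv ℝ (fun p : ℝ × Euc N => F p.1 p.2) (t, x) (1, 0)) t := by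
    intro x
    have h1 := (hF.differentiable (by norm_num) (t, x)).hasFDerivAt
    exact h1.comp_hasDerivAt (f := fun s => (s, x)) t ((hasDerivAt_id t).prodMk (hasDerivAt_const t x))
  simp only [(hd _).deriv]
  have := (hF.continuous_fderiv (by norm_num)).clm_apply (continuous_const (y := ((1:ℝ), (0 : Euc N))))
  exact this.comp (by fun_prop : Continuous fun x : Euc N => (t, x))

lemma sol_cont (hsol : IsEPSolution N K γ β g Ω ⊤ ρ u) {t : ℝ} (ht : 0 ≤ t) (x : Euc N) :
    deriv (fun s => ρ s x) t + ∑ i, epartial i (fun y => ρ t y * u t y i) x = 0 :=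
  hsol.continuity_eq t ht (EReal.coe_lt_top t) x

lemma int_B {B : Set (Euc N)} (hB : IsCompact B) {f : Euc N → ℝ} (hf : Continuous f) :
    IntegrableOn f B volume := hf.continuousOn.integrableOn_compact hB

lemma ionsub {B : Set (Euc N)} {f h : Euc N → ℝ} (hf : IntegrableOn f B volume)
    (hh : IntegrableOn h B volume) : IntegrableOn (fun x => f x - h x) B volume := hf.sub hh

lemma ionadd {B : Set (Euc N)} {f h : Euc N → ℝ} (hf : IntegrableOn f B volume)
    (hh : IntegrableOn h B volume) : IntegrableOn (fun x => f x + h x) B volume := hf.add hh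

lemma ioncm {B : Set (Euc N)} {f : Euc N → ℝ} (c : ℝ) (hf : IntegrableOn f B volume) :
    IntegrableOn (fun x => c * f x) B volume := hf.const_mul c

/-- Derivative of the second inertia function. -/
lemma evo_H (hsol : IsEPSolution N K γ β g Ω ⊤ ρ u) {B : Set (Euc N)} (hB : IsCompact B)
    (hs : ∀ t, 0 ≤ t → ∀ x, x ∉ B → ρ t x = 0) {t : ℝ} (ht : 0 ≤ t) :
    HasDerivAt (fun s => ∫ x in B, (∑ i, x i ^ 2) * ρ s x)
      (2 * ∑ j, ∫ x in B, x j * (ρ t x * u t x j)) t := by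
  have h := hasDerivAt_param_C1 (volume : Measure (Euc N)) hB (k := fun x => ∑ i, x i ^ 2)
    (int_B hB (by fun_prop)) hsol.rho_C1 t
  convert h using 1
  have hr := slice_C1 hsol.rho_C1 t
  have hu := fun j => slice_C1 (F := fun t x => u t x j) (sol_uj hsol j) t
  have hpt : ∀ x : Euc N, (∑ i, x i ^ 2) * deriv (fun s => ρ s x) t
      = ∑ j, (2 * (x j * (ρ t x * u t x j)) - epartial j (fun y => (∑ i, y i ^ 2) * (ρ t y * u t y j)) x) := by
    intro x
    have hc := sol_cont hsol ht x
    have he : ∀ j, epartial j (fun y : Euc N => (∑ i, y i ^ 2) * (ρ t y * u t y j)) x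
        = 2 * (x j * (ρ t x * u t x j)) + (∑ i, x i ^ 2) * epartial j (fun y => ρ t y * u t y j) x := by
      intro j
      have hd : DifferentiableAt ℝ (fun y => ρ t y * u t y j) x :=
        (hr.mul (hu j)).differentiable (by norm_num) x
      rw [epartial_mul (by fun_prop) hd, epartial_sum (by intro j; fun_prop)]
      have : ∀ i, epartial j (fun y : Euc N => y i ^ 2) x = if i = j then 2 * x i else 0 := by
        intro i
        rw [epartial_sq (by fun_prop), epartial_coord]
        split_ifs <;> ring
      simp only [this, Finset.sum_ite_eq', Finset.mem_univ, if_true]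
      ring
    simp only [he, sub_add_cancel_left, Finset.sum_neg_distrib, ← Finset.mul_sum]
    linear_combination (∑ i, x i ^ 2) * hc
  simp only [hpt]
  have hQ : ∀ j, ContDiff ℝ 1 (fun y : Euc N => (∑ i, y i ^ 2) * (ρ t y * u t y j)) := by
    intro j
    exact ContDiff.mul (by fun_prop) (hr.mul (hu j))
  have hc1 : ∀ j, Continuous (fun x : Euc N => x j * (ρ t x * u t x j)) := by
    intro j
    have aux : ∀ w r : Euc N → ℝ, Continuous w → Continuous r →
      Continuous (fun x : Euc N => x j * (r x * w x)) := by intro w r hw hr; fun_prop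
    exact aux _ _ (hu j).continuous hr.continuous
  have i1 : ∀ j, IntegrableOn (fun x : Euc N => 2 * (x j * (ρ t x * u t x j))) B volume :=
    fun j => int_B hB ((hc1 j).const_mul 2)
  have i2 : ∀ j, IntegrableOn (epartial j (fun y : Euc N => (∑ i, y i ^ 2) * (ρ t y * u t y j))) B volume :=
    fun j => int_B hB (epartial_cont (hQ j) j)
  rw [integral_finsetSum _ (fun j _ => ionsub (i1 j) (i2 j)), Finset.mul_sum]
  refine Finset.sum_congr rfl fun j _ => ?_
  rw [integral_sub (i1 j) (i2 j), integral_const_mul,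
    int_epartial hB (hQ j) (fun x hx => by rw [hs t ht x hx]; ring)]
  ring

/-- Derivative of the `j`-th first moment. -/
lemma evo_A (hN : 4 ≤ N) (hγ : 1 < γ)
    (hsol : IsEPSolution N K γ β g Ω ⊤ ρ u) {B : Set (Euc N)} (hB : IsCompact B)
    (hs : ∀ t, 0 ≤ t → ∀ x, x ∉ B → ρ t x = 0) {t : ℝ} (ht : 0 ≤ t) (j : Fin N) :
    HasDerivAt (fun s => ∫ x in B, x j * (ρ s x * u s x j))
      ((∫ x in B, (ρ t x * u t x j ^ 2 + K * ρ t x ^ γ + ρ t x * potential N g ρ t x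
        + x j * epartial j (ρ t) x * potential N g ρ t x))
        - β * ∫ x in B, x j * (ρ t x * u t x j)) t := by
  have h := hasDerivAt_param_C1 (volume : Measure (Euc N)) hB (k := fun x => x j)
    (int_B hB (by fun_prop)) (F := fun s x => ρ s x * u s x j) (hsol.rho_C1.mul (sol_uj hsol j)) t
  convert h using 1
  have hr := slice_C1 hsol.rho_C1 t
  have hu := fun j => slice_C1 (F := fun t x => u t x j) (sol_uj hsol j) t
  have hφ : ContDiff ℝ 1 (potential N g ρ t) :=
    potential_C1 hN g hr (HasCompactSupport.intro hB (hs t ht))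
  have hp : ContDiff ℝ 1 (fun y => K * ρ t y ^ γ) :=
    contDiff_const.mul (ContDiff.rpow_const_of_le (m := 1) hr (by exact_mod_cast hγ.le))
  set φ := potential N g ρ t with hφdef
  have hxj : ContDiff ℝ 1 (fun y : Euc N => y j) := by fun_prop
  have hQ : ∀ i, ContDiff ℝ 1 (fun y : Euc N => ρ t y * u t y i * u t y j) :=
    fun i => (hr.mul (hu i)).mul (hu j)
  have dif : ∀ {f : Euc N → ℝ}, ContDiff ℝ 1 f → ∀ x, DifferentiableAt ℝ f x :=
    fun hf x => hf.differentiable (by norm_num) x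
  have hpt : ∀ x : Euc N, x j * deriv (fun s => ρ s x * u s x j) t
      = (ρ t x * u t x j ^ 2 + K * ρ t x ^ γ + ρ t x * φ x + x j * epartial j (ρ t) x * φ x)
        - β * (x j * (ρ t x * u t x j))
        - ∑ i, epartial i (fun y => y j * (ρ t y * u t y i * u t y j)) x
        - epartial j (fun y => y j * (K * ρ t y ^ γ)) x
        - epartial j (fun y => y j * (ρ t y * φ y)) x := by
    intro x
    have hm := hsol.momentum_eq t ht (EReal.coe_lt_top t) x j
    rw [epartial_mul (dif hxj x) (dif (hr.mul hφ) x), epartial_mul (dif hr x) (dif hφ x),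
      epartial_mul (dif hxj x) (dif hp x)]
    have h1 : ∀ i, epartial i (fun y => y j * (ρ t y * u t y i * u t y j)) x
        = (if j = i then ρ t x * u t x i * u t x j else 0)
          + x j * epartial i (fun y => ρ t y * u t y i * u t y j) x := by
      intro i
      rw [epartial_mul (dif hxj x) (dif (hQ i) x), epartial_coord]
      split_ifs <;> ring
    simp only [h1, Finset.sum_add_distrib, Finset.sum_ite_eq, Finset.mem_univ, if_true,
      ← Finset.mul_sum, epartial_coord]
    rw [← hφdef] at hm
    linear_combination x j * hm
  simp only [hpt]
  have aux : ∀ w r p f d : Euc N → ℝ, Continuous w → Continuous r → Continuous p → Continuous f →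
      Continuous d →
      Continuous (fun x : Euc N => r x * w x ^ 2 + p x + r x * f x + x j * d x * f x) := by
    intro w r p f d hw hr hp hf hd; fun_prop
  have aux2 : ∀ w r : Euc N → ℝ, Continuous w → Continuous r →
      Continuous (fun x : Euc N => x j * (r x * w x)) := by intro w r hw hr; fun_prop
  have c1 : Continuous (fun x => ρ t x * u t x j ^ 2 + K * ρ t x ^ γ + ρ t x * φ x + x j * epartial j (ρ t) x * φ x) :=
    aux _ _ _ _ _ (hu j).continuous hr.continuous hp.continuous hφ.continuous (epartial_cont hr j)
  have c2 : Continuous (fun x : Euc N => x j * (ρ t x * u t x j)) :=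
    aux2 _ _ (hu j).continuous hr.continuous
  have q1 : ∀ i, ContDiff ℝ 1 (fun y : Euc N => y j * (ρ t y * u t y i * u t y j)) := fun i => hxj.mul (hQ i)
  have q2 : ContDiff ℝ 1 (fun y : Euc N => y j * (K * ρ t y ^ γ)) := hxj.mul hp
  have q3 : ContDiff ℝ 1 (fun y : Euc N => y j * (ρ t y * φ y)) := hxj.mul (hr.mul hφ)
  have i1 := int_B hB c1
  have i2 := int_B hB (c2.const_mul β)
  have i3 := fun i => int_B hB (epartial_cont (q1 i) i)
  have i4 := int_B hB (epartial_cont q2 j)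
  have i5 := int_B hB (epartial_cont q3 j)
  have i3' : IntegrableOn (fun x => ∑ i, epartial i (fun y => y j * (ρ t y * u t y i * u t y j)) x) B volume :=
    integrable_finsetSum _ (fun i _ => i3 i)
  rw [integral_sub (ionsub (ionsub (ionsub i1 i2) i3') i4) i5, integral_sub (ionsub (ionsub i1 i2) i3') i4,
    integral_sub (ionsub i1 i2) i3', integral_sub i1 i2, integral_const_mul,
    integral_finsetSum _ (fun i _ => i3 i),
    int_epartial hB q2 (fun x hx => by rw [hs t ht x hx, Real.zero_rpow (by linarith)]; ring),
    int_epartial hB q3 (fun x hx => by rw [hs t ht x hx]; ring),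
    Finset.sum_eq_zero (fun i _ => int_epartial hB (q1 i) (fun x hx => by rw [hs t ht x hx]; ring) i)]
  ring

/-- Energy dissipation. -/
lemma evo_E (hN : 4 ≤ N) (hγ : 1 < γ)
    (hsol : IsEPSolution N K γ β g Ω ⊤ ρ u) {R : ℝ}
    (hs : ∀ t, 0 ≤ t → ∀ x, x ∉ Metric.closedBall (0 : Euc N) R → ρ t x = 0) {t : ℝ} (ht : 0 ≤ t) :
    HasDerivAt (fun s => (∫ x in Metric.closedBall (0 : Euc N) R,
        1 * (1 / 2 * ρ s x * (∑ j, u s x j ^ 2) + K * ρ s x ^ γ / (γ - 1)))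
        + g / 2 * ∫ z in Metric.closedBall (0 : Euc N) R ×ˢ Metric.closedBall (0 : Euc N) R,
            green N (z.1 - z.2) * (ρ s z.1 * ρ s z.2))
      (- β * ∫ x in Metric.closedBall (0 : Euc N) R, ρ t x * ∑ j, u t x j ^ 2) t := by
  set B := Metric.closedBall (0 : Euc N) R with hBdef
  have hB : IsCompact B := isCompact_closedBall _ _
  have hγ0 : γ - 1 ≠ 0 := by linarith
  have hp1 : ContDiff ℝ 1 (fun p : ℝ × Euc N => ρ p.1 p.2 ^ γ) :=
    ContDiff.rpow_const_of_le (m := 1) hsol.rho_C1 (by exact_mod_cast hγ.le)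
  have hS1 : ContDiff ℝ 1 (fun p : ℝ × Euc N => ∑ j, u p.1 p.2 j ^ 2) :=
    ContDiff.sum fun j _ => (sol_uj hsol j).pow 2
  have hF1 : ContDiff ℝ 1 (fun p : ℝ × Euc N =>
      1 / 2 * ρ p.1 p.2 * (∑ j, u p.1 p.2 j ^ 2) + K * ρ p.1 p.2 ^ γ / (γ - 1)) :=
    ((contDiff_const.mul hsol.rho_C1).mul hS1).add ((contDiff_const.mul hp1).div_const _)
  have hF2 : ContDiff ℝ 1 (fun p : ℝ × (Euc N × Euc N) => ρ p.1 p.2.1 * ρ p.1 p.2.2) :=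
    (hsol.rho_C1.comp (contDiff_fst.prodMk (contDiff_fst.comp contDiff_snd))).mul
      (hsol.rho_C1.comp (contDiff_fst.prodMk (contDiff_snd.comp contDiff_snd)))
  have h1 := hasDerivAt_param_C1 (volume : Measure (Euc N)) hB (k := fun _ => 1)
    (int_B hB continuous_const)
    (F := fun s x => 1 / 2 * ρ s x * (∑ j, u s x j ^ 2) + K * ρ s x ^ γ / (γ - 1)) hF1 t
  have h2 := hasDerivAt_param_C1 (volume : Measure (Euc N × Euc N)) (hB.prod hB) (kernel_int hN R)
    (F := fun s z => ρ s z.1 * ρ s z.2) hF2 t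
  refine (h1.fun_add (h2.const_mul (g / 2))).congr_deriv ?_
  symm
  have hr := slice_C1 hsol.rho_C1 t
  have hu := fun j => slice_C1 (F := fun t x => u t x j) (sol_uj hsol j) t
  have hS := slice_C1 (F := fun t x => ∑ j, u t x j ^ 2) hS1 t
  have hφ : ContDiff ℝ 1 (potential N g ρ t) :=
    potential_C1 hN g hr (HasCompactSupport.intro hB (hs t ht))
  have hp : ContDiff ℝ 1 (fun y => K * ρ t y ^ γ) :=
    contDiff_const.mul (ContDiff.rpow_const_of_le (m := 1) hr (by exact_mod_cast hγ.le))
  have hrt := fun x => slice_t hsol.rho_C1 t x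
  have hut := fun j x => slice_t (F := fun t x => u t x j) (sol_uj hsol j) t x
  have crt := cont_deriv_t hsol.rho_C1 t
  have d2 : ∀ z : Euc N × Euc N, deriv (fun s => ρ s z.1 * ρ s z.2) t
      = deriv (fun s => ρ s z.1) t * ρ t z.2 + ρ t z.1 * deriv (fun s => ρ s z.2) t :=
    fun z => ((hrt z.1).fun_mul (hrt z.2)).deriv
  have hsym := pot_pair_sym hN g R crt hr.continuous (hs t ht)
  rw [← hBdef] at hsym
  simp only [d2]
  have hsym' : g / 2 * ∫ z in B ×ˢ B, green N (z.1 - z.2) *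
      (deriv (fun s => ρ s z.1) t * ρ t z.2 + ρ t z.1 * deriv (fun s => ρ s z.2) t)
      = ∫ x in B, deriv (fun s => ρ s x) t * potential N g ρ t x := by
    linear_combination (1 / 2) * hsym
  rw [hsym']
  set φ := potential N g ρ t with hφdef
  have cF1 := cont_deriv_t (F := fun s x => 1 / 2 * ρ s x * (∑ j, u s x j ^ 2) + K * ρ s x ^ γ / (γ - 1)) hF1 t
  simp only [one_mul]
  have crtφ : Continuous (fun x => deriv (fun s => ρ s x) t * φ x) := crt.mul hφ.continuous
  rw [← integral_add (int_B hB cF1) (int_B hB crtφ)]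
  have dif : ∀ {f : Euc N → ℝ}, ContDiff ℝ 1 f → ∀ x, DifferentiableAt ℝ f x :=
    fun hf x => hf.differentiable (by norm_num) x
  have q1 : ∀ i, ContDiff ℝ 1 (fun y => ρ t y * u t y i) := fun i => hr.mul (hu i)
  have qa : ∀ i, ContDiff ℝ 1 (fun y => (ρ t y * u t y i) * ∑ j, u t y j ^ 2) := fun i => (q1 i).mul hS
  have qb : ∀ i, ContDiff ℝ 1 (fun y => (K * ρ t y ^ γ) * u t y i) := fun i => hp.mul (hu i)
  have qc : ∀ i, ContDiff ℝ 1 (fun y => (ρ t y * u t y i) * φ y) := fun i => (q1 i).mul hφ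
  have hpt : ∀ x : Euc N,
      deriv (fun s => 1 / 2 * ρ s x * (∑ j, u s x j ^ 2) + K * ρ s x ^ γ / (γ - 1)) t
        + deriv (fun s => ρ s x) t * φ x
      = - (∑ i, (1 / 2 * epartial i (fun y => (ρ t y * u t y i) * ∑ j, u t y j ^ 2) x
          + γ / (γ - 1) * epartial i (fun y => (K * ρ t y ^ γ) * u t y i) x
          + epartial i (fun y => (ρ t y * u t y i) * φ y) x)) - β * (ρ t x * ∑ j, u t x j ^ 2) := by
    intro x
    have hqr : ρ t x ^ γ = ρ t x * ρ t x ^ (γ - 1) := by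
      rcases (hsol.rho_nonneg t x).eq_or_lt with h0 | h0
      · rw [← h0, Real.zero_rpow (by linarith), zero_mul]
      · rw [Real.rpow_sub_one h0.ne']; field_simp
    have hc := sol_cont hsol ht x
    have hm := fun j => hsol.momentum_eq t ht (EReal.coe_lt_top t) x j
    have e1 : ∀ i, epartial i (fun y => ρ t y * u t y i) x
        = epartial i (ρ t) x * u t x i + ρ t x * epartial i (fun y => u t y i) x :=
      fun i => epartial_mul (dif hr x) (dif (hu i) x) i
    have e2 : ∀ i j, epartial i (fun y => ρ t y * u t y i * u t y j) x
        = (epartial i (ρ t) x * u t x i + ρ t x * epartial i (fun y => u t y i) x) * u t x j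
          + ρ t x * u t x i * epartial i (fun y => u t y j) x := by
      intro i j
      rw [epartial_mul (dif (q1 i) x) (dif (hu j) x), e1]
    have e3 : ∀ i, epartial i (fun y => K * ρ t y ^ γ) x
        = K * (γ * ρ t x ^ (γ - 1) * epartial i (ρ t) x) := by
      intro i
      rw [epartial_const_mul (f := fun y => ρ t y ^ γ) (dif (ContDiff.rpow_const_of_le (m := 1) hr (by exact_mod_cast hγ.le)) x),
        epartial_rpow (dif hr x) hγ.le]
    have e4 : ∀ j, deriv (fun s => ρ s x * u s x j) t
        = deriv (fun s => ρ s x) t * u t x j + ρ t x * deriv (fun s => u s x j) t :=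
      fun j => ((hrt x).fun_mul (hut j x)).deriv
    have e5 : deriv (fun s => 1 / 2 * ρ s x * (∑ j, u s x j ^ 2) + K * ρ s x ^ γ / (γ - 1)) t
        = (1 / 2 * deriv (fun s => ρ s x) t * (∑ j, u t x j ^ 2)
          + 1 / 2 * ρ t x * ∑ j, 2 * u t x j * deriv (fun s => u s x j) t)
          + K * (γ * ρ t x ^ (γ - 1) * deriv (fun s => ρ s x) t) / (γ - 1) := by
      have a1 : HasDerivAt (fun s => ∑ j, u s x j ^ 2) (∑ j, 2 * u t x j * deriv (fun s => u s x j) t) t := by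
        refine HasDerivAt.fun_sum fun j _ => ?_
        have := (hut j x).fun_pow 2
        simpa using this
      have a2 : HasDerivAt (fun s => ρ s x ^ γ) (γ * ρ t x ^ (γ - 1) * deriv (fun s => ρ s x) t) t := by
        have := (hrt x).rpow_const (p := γ) (Or.inr hγ.le)
        convert this using 1; ring
      exact ((((hrt x).const_mul (1/2)).fun_mul a1).fun_add ((a2.const_mul K).div_const _)).deriv
    have e6 : ∀ i, epartial i (fun y => (ρ t y * u t y i) * ∑ j, u t y j ^ 2) x
        = (epartial i (ρ t) x * u t x i + ρ t x * epartial i (fun y => u t y i) x) * (∑ j, u t x j ^ 2)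
          + ρ t x * u t x i * ∑ j, 2 * u t x j * epartial i (fun y => u t y j) x := by
      intro i
      rw [epartial_mul (dif (q1 i) x) (dif hS x), e1,
        epartial_sum (f := fun j y => u t y j ^ 2) (fun j => dif ((hu j).pow 2) x)]
      congr 2
      exact Finset.sum_congr rfl fun j _ => epartial_sq (f := fun y => u t y j) (dif (hu j) x) i
    have e7 : ∀ i, epartial i (fun y => (K * ρ t y ^ γ) * u t y i) x
        = K * (γ * ρ t x ^ (γ - 1) * epartial i (ρ t) x) * u t x i
          + K * (ρ t x * ρ t x ^ (γ - 1)) * epartial i (fun y => u t y i) x := by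
      intro i
      rw [epartial_mul (dif hp x) (dif (hu i) x), e3, hqr]
    have e8 : ∀ i, epartial i (fun y => (ρ t y * u t y i) * φ y) x
        = (epartial i (ρ t) x * u t x i + ρ t x * epartial i (fun y => u t y i) x) * φ x
          + ρ t x * u t x i * epartial i φ x := by
      intro i
      rw [epartial_mul (dif (q1 i) x) (dif hφ x), e1]
    simp only [e1] at hc
    simp only [e2, e3, e4, ← hφdef] at hm
    rw [e5]
    simp only [e6, e7, e8]
    exact energy_alg N (ρ t x) (deriv (fun s => ρ s x) t) (φ x) (ρ t x ^ (γ - 1)) K γ β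
      (fun i => epartial i (ρ t) x) (fun i => u t x i) (fun i => deriv (fun s => u s x i) t)
      (fun i => epartial i φ x) (fun i j => epartial i (fun y => u t y j) x) hγ0 hc hm
  simp only [hpt]
  have ia := fun i => ioncm (1 / 2) (int_B hB (epartial_cont (qa i) i))
  have ib := fun i => ioncm (γ / (γ - 1)) (int_B hB (epartial_cont (qb i) i))
  have ic := fun i => int_B hB (epartial_cont (qc i) i)
  have iab : ∀ i, IntegrableOn (fun x => 1 / 2 * epartial i (fun y => (ρ t y * u t y i) * ∑ j, u t y j ^ 2) x
          + γ / (γ - 1) * epartial i (fun y => (K * ρ t y ^ γ) * u t y i) x) B volume :=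
    fun i => (ia i).add (ib i)
  have iabc : ∀ i, IntegrableOn (fun x => 1 / 2 * epartial i (fun y => (ρ t y * u t y i) * ∑ j, u t y j ^ 2) x
          + γ / (γ - 1) * epartial i (fun y => (K * ρ t y ^ γ) * u t y i) x
          + epartial i (fun y => (ρ t y * u t y i) * φ y) x) B volume :=
    fun i => (iab i).add (ic i)
  have isum : IntegrableOn (fun x => - ∑ i, (1 / 2 * epartial i (fun y => (ρ t y * u t y i) * ∑ j, u t y j ^ 2) x
          + γ / (γ - 1) * epartial i (fun y => (K * ρ t y ^ γ) * u t y i) x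
          + epartial i (fun y => (ρ t y * u t y i) * φ y) x)) B volume :=
    (integrable_finsetSum _ (fun i _ => iabc i)).neg
  have iS : IntegrableOn (fun x => β * (ρ t x * ∑ j, u t x j ^ 2)) B volume :=
    int_B hB (continuous_const.mul (hr.continuous.mul hS.continuous))
  rw [integral_sub isum iS, integral_neg, integral_finsetSum _ (fun i _ => iabc i), integral_const_mul,
    Finset.sum_eq_zero]
  · ring
  intro i _
  rw [integral_add (iab i) (ic i), integral_add (ia i) (ib i), integral_const_mul, integral_const_mul,
    int_epartial hB (qa i) (fun x hx => by rw [hs t ht x hx]; ring),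
    int_epartial hB (qb i) (fun x hx => by rw [hs t ht x hx, Real.zero_rpow (by linarith)]; ring),
    int_epartial hB (qc i) (fun x hx => by rw [hs t ht x hx]; ring)]
  ring

lemma norm_sq_sum (x : Euc N) : ‖x‖ ^ 2 = ∑ j, x j ^ 2 := EuclideanSpace.real_norm_sq_eq x

/-- The energy in terms of integrals over a ball. -/
lemma energy_split (hN : 4 ≤ N) (hγ : 1 < γ)
    (hsol : IsEPSolution N K γ β g Ω ⊤ ρ u) {R : ℝ}
    (hΩ : Ω ⊆ Metric.closedBall (0 : Euc N) R) {t : ℝ} (ht : 0 ≤ t)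
    (hs : ∀ x, x ∉ Metric.closedBall (0 : Euc N) R → ρ t x = 0) :
    energy N K γ g Ω ρ u t = ∫ x in Metric.closedBall (0 : Euc N) R,
      (1 / 2 * ρ t x * (∑ j, u t x j ^ 2) + K * ρ t x ^ γ / (γ - 1)
        + 1 / 2 * ρ t x * potential N g ρ t x) := by
  have h0 : ∀ x, ρ t x = 0 → (1 / 2 * ρ t x * ‖u t x‖ ^ 2 + K * ρ t x ^ γ / (γ - 1)
        + 1 / 2 * ρ t x * potential N g ρ t x) = 0 := by
    intro x hx
    rw [hx, Real.zero_rpow (by linarith)]; ring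
  have hΩ0 : ∀ x, x ∉ Ω → ρ t x = 0 := by
    intro x hx
    by_contra h
    exact hx (hsol.support_subset t ht (EReal.coe_lt_top t) h)
  unfold energy
  simp only [← norm_sq_sum]
  rw [setIntegral_eq_integral_of_forall_compl_eq_zero (fun x hx => h0 x (hΩ0 x hx)),
    setIntegral_eq_integral_of_forall_compl_eq_zero (fun x hx => h0 x (hs x hx))]

end evo
/-- For `N ≥ 4`, `β > 0` and `1 < γ ≤ 2(N-1)/N`, there is no
global classical solution of the damped Euler–Poisson equations whose initial
total energy satisfies `E(0) < 0`. -/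
theorem blowup_damped_negative_energy (N : ℕ) (hN : 4 ≤ N) (K γ β g : ℝ)
    (hK : 0 < K) (hg : 0 < g) (hβ : 0 < β)
    (hγ1 : 1 < γ) (hγ2 : γ ≤ 2 * ((N : ℝ) - 1) / N)
    (Ω : Set (Euc N)) (ρ : ℝ → Euc N → ℝ) (u : ℝ → Euc N → Euc N)
    (hsol : IsEPSolution N K γ β g Ω ⊤ ρ u)
    (hE0 : energy N K γ g Ω ρ u 0 < 0) :
    False := by
  have hN4 : (4:ℝ) ≤ N := by exact_mod_cast hN
  obtain ⟨R, hRpos, hR⟩ := hsol.omega_bounded.exists_pos_norm_le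
  set B := Metric.closedBall (0 : Euc N) R with hBdef
  have hB : IsCompact B := isCompact_closedBall _ _
  have hΩB : Ω ⊆ B := fun x hx => by simpa [hBdef] using hR x hx
  have hs : ∀ t, 0 ≤ t → ∀ x, x ∉ B → ρ t x = 0 := by
    intro t ht x hx
    by_contra h
    exact hx (hΩB (hsol.support_subset t ht (EReal.coe_lt_top t) h))
  -- continuity facts
  have hr := fun t => slice_C1 hsol.rho_C1 t
  have hu := fun t j => slice_C1 (F := fun t x => u t x j) (sol_uj hsol j) t
  have hS1 : ContDiff ℝ 1 (fun p : ℝ × Euc N => ∑ j, u p.1 p.2 j ^ 2) :=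
    ContDiff.sum fun j _ => (sol_uj hsol j).pow 2
  have hS := fun t => slice_C1 (F := fun t x => ∑ j, u t x j ^ 2) hS1 t
  have hp : ∀ t, ContDiff ℝ 1 (fun y => K * ρ t y ^ γ) := fun t =>
    contDiff_const.mul (ContDiff.rpow_const_of_le (m := 1) (hr t) (by exact_mod_cast hγ1.le))
  have hφ : ∀ t, 0 ≤ t → ContDiff ℝ 1 (potential N g ρ t) := fun t ht =>
    potential_C1 hN g (hr t) (HasCompactSupport.intro hB (hs t ht))
  -- basic integrals
  set kin : ℝ → ℝ := fun t => ∫ x in B, ρ t x * ∑ j, u t x j ^ 2 with hkin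
  set prs : ℝ → ℝ := fun t => ∫ x in B, K * ρ t x ^ γ with hprs
  set pot : ℝ → ℝ := fun t => ∫ x in B, ρ t x * potential N g ρ t x with hpot
  have kin0 : ∀ t, 0 ≤ kin t := fun t => integral_nonneg fun x =>
    mul_nonneg (hsol.rho_nonneg t x) (Finset.sum_nonneg fun j _ => sq_nonneg _)
  have prs0 : ∀ t, 0 ≤ prs t := fun t => integral_nonneg fun x =>
    mul_nonneg hK.le (Real.rpow_nonneg (hsol.rho_nonneg t x) _)
  have ikin : ∀ t, IntegrableOn (fun x => ρ t x * ∑ j, u t x j ^ 2) B volume := fun t =>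
    int_B hB ((hr t).continuous.mul (hS t).continuous)
  have iprs : ∀ t, IntegrableOn (fun x => K * ρ t x ^ γ) B volume := fun t => int_B hB (hp t).continuous
  have ipot : ∀ t, 0 ≤ t → IntegrableOn (fun x => ρ t x * potential N g ρ t x) B volume := fun t ht =>
    int_B hB ((hr t).continuous.mul (hφ t ht).continuous)
  -- energy
  set EB : ℝ → ℝ := fun s => (∫ x in B,
        1 * (1 / 2 * ρ s x * (∑ j, u s x j ^ 2) + K * ρ s x ^ γ / (γ - 1)))
        + g / 2 * ∫ z in B ×ˢ B, green N (z.1 - z.2) * (ρ s z.1 * ρ s z.2) with hEB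
  have hEBd : ∀ t, 0 ≤ t → HasDerivAt EB (-β * kin t) t := fun t ht => evo_E hN hγ1 hsol hs ht
  have hEBval : ∀ t, 0 ≤ t → EB t = 1 / 2 * kin t + 1 / (γ - 1) * prs t + 1 / 2 * pot t := by
    intro t ht
    have h1 : (∫ x in B, 1 * (1 / 2 * ρ t x * (∑ j, u t x j ^ 2) + K * ρ t x ^ γ / (γ - 1)))
        = 1 / 2 * kin t + 1 / (γ - 1) * prs t := by
      rw [hkin, hprs]
      simp only
      rw [← integral_const_mul, ← integral_const_mul,
        ← integral_add ((ikin t).const_mul _) ((iprs t).const_mul _)]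
      congr 1; funext x; ring
    have h2 := pot_pair hN g R (hr t).continuous (hr t).continuous (hs t ht)
    rw [← hBdef] at h2
    rw [hEB]
    simp only
    rw [h1, hpot]
    simp only
    rw [← h2]; ring
  have hEval : ∀ t, 0 ≤ t → energy N K γ g Ω ρ u t
      = 1 / 2 * kin t + 1 / (γ - 1) * prs t + 1 / 2 * pot t := by
    intro t ht
    rw [energy_split hN hγ1 hsol hΩB ht (hs t ht), hkin, hprs, hpot]
    simp only
    rw [← integral_const_mul, ← integral_const_mul, ← integral_const_mul,
        ← integral_add (ioncm _ (ikin t)) (ioncm _ (iprs t)),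
        ← integral_add (ionadd (ioncm _ (ikin t)) (ioncm _ (iprs t))) (ioncm _ (ipot t ht))]
    congr 1; funext x; ring
  have hanti : AntitoneOn EB (Set.Ici 0) := by
    refine antitoneOn_of_hasDerivWithinAt_nonpos (f' := fun t => -β * kin t) (convex_Ici 0)
      (fun t ht => (hEBd t ht).continuousAt.continuousWithinAt) ?_ ?_
    · intro t ht
      rw [interior_Ici] at ht
      exact (hEBd t (le_of_lt ht)).hasDerivWithinAt
    · intro t ht
      have := mul_nonneg hβ.le (kin0 t)
      linarith
  set c : ℝ := - ((N - 2) * energy N K γ g Ω ρ u 0) with hc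
  have hcpos : 0 < c := by
    have : (0:ℝ) < N - 2 := by linarith
    rw [hc]; nlinarith
  -- moments
  set A : Fin N → ℝ → ℝ := fun j s => ∫ x in B, x j * (ρ s x * u s x j) with hA
  set J : ℝ → ℝ := fun s => ∑ j, A j s with hJ
  set H : ℝ → ℝ := fun s => ∫ x in B, (∑ i, x i ^ 2) * ρ s x with hH
  have hH0 : ∀ t, 0 ≤ H t := fun t => integral_nonneg fun x =>
    mul_nonneg (Finset.sum_nonneg fun j _ => sq_nonneg _) (hsol.rho_nonneg t x)
  have hHd : ∀ t, 0 ≤ t → HasDerivAt H (2 * J t) t := fun t ht => evo_H hsol hB hs ht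
  have hJd : ∀ t, 0 ≤ t → HasDerivAt J (kin t + N * prs t + (N - 2) / 2 * pot t - β * J t) t := by
    intro t ht
    have h := HasDerivAt.fun_sum (u := Finset.univ) (fun j _ => evo_A hN hγ1 hsol hB hs ht j)
    refine h.congr_deriv ?_
    rw [Finset.sum_sub_distrib, ← Finset.mul_sum]
    congr 1
    have hw := virial hN g hRpos (hr t) (hs t ht)
    rw [← hBdef] at hw
    have hcA : ∀ j, IntegrableOn (fun x => x j * epartial j (ρ t) x * potential N g ρ t x) B volume := by
      intro j
      have a1 := epartial_cont (hr t) j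
      have a2 := (hφ t ht).continuous
      exact int_B hB (by fun_prop)
    have hcK : ∀ j, IntegrableOn (fun x => ρ t x * u t x j ^ 2) B volume := fun j =>
      int_B hB ((hr t).continuous.mul ((hu t j).continuous.pow 2))
    have e1 : ∀ j, (∫ x in B, (ρ t x * u t x j ^ 2 + K * ρ t x ^ γ + ρ t x * potential N g ρ t x
        + x j * epartial j (ρ t) x * potential N g ρ t x))
        = (∫ x in B, ρ t x * u t x j ^ 2) + prs t + pot t
          + ∫ x in B, x j * epartial j (ρ t) x * potential N g ρ t x := by
      intro j
      rw [integral_add (ionadd (ionadd (hcK j) (iprs t)) (ipot t ht)) (hcA j),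
        integral_add (ionadd (hcK j) (iprs t)) (ipot t ht), integral_add (hcK j) (iprs t)]
    simp only [e1, Finset.sum_add_distrib]
    rw [← integral_finsetSum _ (fun j _ => hcK j), ← integral_finsetSum _ (fun j _ => hcA j)]
    simp only [← Finset.sum_mul, ← Finset.mul_sum]
    rw [hw]
    simp only [Finset.sum_const, Finset.card_univ, Fintype.card_fin, nsmul_eq_mul]
    change kin t + N * prs t + N * pot t + -((N + 2) / 2) * pot t = _
    ring
  have hkey : ∀ t, 0 ≤ t → kin t + N * prs t + (N - 2) / 2 * pot t ≤ - c := by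
    intro t ht
    have h1 : EB t ≤ EB 0 := hanti (Set.mem_Ici.2 le_rfl) ht ht
    have h2 : EB 0 = energy N K γ g Ω ρ u 0 := by rw [hEval 0 le_rfl, hEBval 0 le_rfl]
    have h3 := hEBval t ht
    have h4 : (N:ℝ) ≤ (N - 2) * (1 / (γ - 1)) := by
      rw [mul_one_div, le_div_iff₀ (by linarith)]
      rw [le_div_iff₀ (by linarith)] at hγ2
      linarith
    have h5 : (N - 2 : ℝ) * EB t ≤ (N - 2) * EB 0 := mul_le_mul_of_nonneg_left h1 (by linarith)
    have h6 : (N:ℝ) * prs t ≤ (N - 2) * (1 / (γ - 1)) * prs t := mul_le_mul_of_nonneg_right h4 (prs0 t)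
    have h7 : 1 * kin t ≤ ((N - 2) / 2 : ℝ) * kin t :=
      mul_le_mul_of_nonneg_right (by linarith) (kin0 t)
    rw [h2, h3] at h5
    rw [hc]
    linarith
  -- differential inequality
  have hY : AntitoneOn (fun t => J t + β / 2 * H t + c * t) (Set.Ici 0) := by
    have hd : ∀ t, 0 ≤ t → HasDerivAt (fun t => J t + β / 2 * H t + c * t)
        (kin t + N * prs t + (N - 2) / 2 * pot t - β * J t + β / 2 * (2 * J t) + c * 1) t := fun t ht =>
      ((hJd t ht).fun_add ((hHd t ht).const_mul _)).fun_add ((hasDerivAt_id t).const_mul c)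
    refine antitoneOn_of_hasDerivWithinAt_nonpos
      (f' := fun t => kin t + N * prs t + (N - 2) / 2 * pot t - β * J t + β / 2 * (2 * J t) + c * 1)
      (convex_Ici 0)
      (fun t ht => (hd t ht).continuousAt.continuousWithinAt) ?_ ?_
    · intro t ht
      rw [interior_Ici] at ht
      exact (hd t (le_of_lt ht)).hasDerivWithinAt
    · intro t ht
      rw [interior_Ici] at ht
      have := hkey t (le_of_lt ht)
      linarith
  set C := J 0 + β / 2 * H 0 with hC
  have hJle : ∀ t, 0 ≤ t → J t ≤ C - c * t := by
    intro t ht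
    have h1 := hY (Set.mem_Ici.2 le_rfl) (Set.mem_Ici.2 ht) ht
    have h2 : 0 ≤ β / 2 * H t := mul_nonneg (by linarith) (hH0 t)
    simp only at h1
    linarith
  have hZ : AntitoneOn (fun t => H t - 2 * C * t + c * t ^ 2) (Set.Ici 0) := by
    have hd : ∀ t, 0 ≤ t → HasDerivAt (fun t => H t - 2 * C * t + c * t ^ 2)
        (2 * J t - 2 * C * 1 + c * (2 * t)) t := by
      intro t ht
      have hsq : HasDerivAt (fun t : ℝ => t ^ 2) (2 * t) t := by simpa using hasDerivAt_pow 2 t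
      exact ((hHd t ht).fun_sub ((hasDerivAt_id t).const_mul _)).fun_add (hsq.const_mul c)
    refine antitoneOn_of_hasDerivWithinAt_nonpos
      (f' := fun t => 2 * J t - 2 * C * 1 + c * (2 * t))
      (convex_Ici 0)
      (fun t ht => (hd t ht).continuousAt.continuousWithinAt) ?_ ?_
    · intro t ht
      rw [interior_Ici] at ht
      exact (hd t (le_of_lt ht)).hasDerivWithinAt
    · intro t ht
      rw [interior_Ici] at ht
      have := hJle t (le_of_lt ht)
      linarith
  have hHle : ∀ t, 0 ≤ t → c * t ^ 2 ≤ H 0 + 2 * C * t := by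
    intro t ht
    have h1 := hZ (Set.mem_Ici.2 le_rfl) (Set.mem_Ici.2 ht) ht
    have h2 := hH0 t
    simp only at h1
    linarith
  set T := (H 0 + 2 * |C| + 1) / c + 1 with hT
  have hcT : c * T = H 0 + 2 * |C| + 1 + c := by rw [hT]; field_simp
  have hT1 : 1 ≤ T := by
    rw [hT]
    have : 0 ≤ (H 0 + 2 * |C| + 1) / c := div_nonneg (by linarith [hH0 0, abs_nonneg C]) hcpos.le
    linarith
  have h1 := hHle T (by linarith)
  have h2 : c * T ^ 2 = (H 0 + 2 * |C| + 1 + c) * T := by rw [pow_two, ← mul_assoc, hcT]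
  have h3 : C * T ≤ |C| * T := mul_le_mul_of_nonneg_right (le_abs_self C) (by linarith)
  have h4 : H 0 * 1 ≤ H 0 * T := mul_le_mul_of_nonneg_left hT1 (hH0 0)
  nlinarith
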